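/- Let U be a unitary operator on a complex Hilbert space and let a, b > 0. For θ ∈ ℝ set N(θ) = a·I + (b/4)·(2·I − e^{iθ}U* − e^{−iθ}U). Then each N(θ) is a positive invertible operator and ‖∫_0^{2π} N(θ)⁻¹ dθ‖ = sup over e^{iφ} ∈ σ(U) of ∫_0^{2π} (a + (b/2)(1 − cos(θ − φ)))⁻¹ dθ = 2π/√(a² + ab). -/

import Mathlib

open Complex

/-- `N(θ) = a·I + (b/4)·(2·I − e^{iθ}U* − e^{−iθ}U)`. -/
noncomputable def Nop {H : Type*} [NormedAddCommGroup H] [InnerProductSpace ℂ H]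
    [CompleteSpace H] (a b θ : ℝ) (U : H →L[ℂ] H) : H →L[ℂ] H :=
  (a : ℂ) • (1 : H →L[ℂ] H) +
    ((b / 4 : ℝ) : ℂ) •
      ((2 : ℂ) • (1 : H →L[ℂ] H) -
        Complex.exp ((θ : ℂ) * Complex.I) • ContinuousLinearMap.adjoint U -
        Complex.exp (-(θ : ℂ) * Complex.I) • U)

section Aux

variable {A : Type*} [NormedRing A] [NormedAlgebra ℂ A] [CompleteSpace A]

lemma aux_unit (r : ℝ) (hr0 : 0 ≤ r) (hr : r < 1) (u : A) (hu : ‖u‖ ≤ 1) (z : ℂ) (hz : ‖z‖ ≤ 1) :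
    IsUnit (1 - ((r : ℂ) * z) • u) := by
  apply isUnit_one_sub_of_norm_lt_one
  rw [norm_smul, norm_mul, Complex.norm_real, Real.norm_of_nonneg hr0]
  have : ‖z‖ * ‖u‖ ≤ 1 := mul_le_one₀ hz (norm_nonneg _) hu
  nlinarith [norm_nonneg z, norm_nonneg u]

lemma aux_cont (r : ℝ) (hr0 : 0 ≤ r) (hr : r < 1) (u : A) (hu : ‖u‖ ≤ 1)
    (g : ℝ → ℂ) (hg : Continuous g) (hz : ∀ t, ‖g t‖ ≤ 1) :
    Continuous (fun θ : ℝ => Ring.inverse (1 - ((r : ℂ) * g θ) • u)) := by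
  rw [continuous_iff_continuousAt]
  intro t
  obtain ⟨w, hw⟩ := aux_unit r hr0 hr u hu (g t) (hz t)
  have h1 := NormedRing.inverse_continuousAt w
  rw [hw] at h1
  exact ContinuousAt.comp (f := fun θ : ℝ => (1 - ((r : ℂ) * g θ) • u)) h1
    (by fun_prop)

lemma aux_int (r : ℝ) (hr0 : 0 ≤ r) (hr : r < 1) (u : A) (hu : ‖u‖ ≤ 1) :
    ∫ θ in (0 : ℝ)..(2 * Real.pi),
      Ring.inverse (1 - ((r : ℂ) * Complex.exp ((θ : ℂ) * Complex.I)) • u) =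
      (2 * Real.pi) • (1 : A) := by
  have hd : DifferentiableOn ℂ (fun z : ℂ => Ring.inverse (1 - ((r : ℂ) * z) • u))
      (Metric.closedBall 0 1) := by
    apply DifferentiableOn.inverse
    · fun_prop
    · intro z hz
      exact aux_unit r hr0 hr u hu z (by simpa using hz)
  have h := DiffContOnCl.circleAverage (c := 0) (R := 1)
    (f := fun z : ℂ => Ring.inverse (1 - ((r : ℂ) * z) • u)) (by
      apply DifferentiableOn.diffContOnCl
      rw [abs_one, closure_ball _ one_ne_zero]
      exact hd)
  rw [Real.circleAverage_def] at h
  simp only [circleMap, zero_add, Complex.ofReal_one, one_mul, mul_zero, zero_smul, sub_zero,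
    Ring.inverse_one] at h
  rw [inv_smul_eq_iff₀ (by positivity)] at h
  exact h

lemma aux_int' (r : ℝ) (hr0 : 0 ≤ r) (hr : r < 1) (u : A) (hu : ‖u‖ ≤ 1) :
    ∫ θ in (0 : ℝ)..(2 * Real.pi),
      Ring.inverse (1 - ((r : ℂ) * Complex.exp (-(θ : ℂ) * Complex.I)) • u) =
      (2 * Real.pi) • (1 : A) := by
  rw [← aux_int r hr0 hr u hu]
  have := intervalIntegral.integral_comp_sub_left (a := 0) (b := 2 * Real.pi)
    (fun θ : ℝ => Ring.inverse (1 - ((r : ℂ) * Complex.exp ((θ : ℂ) * Complex.I)) • u))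
    (2 * Real.pi)
  simp only [sub_self, sub_zero] at this
  rw [← this]
  congr 1
  ext θ
  have : Complex.exp (((2 * Real.pi - θ : ℝ) : ℂ) * Complex.I)
      = Complex.exp (-(θ : ℂ) * Complex.I) := by
    rw [← Complex.exp_periodic (-(θ : ℂ) * Complex.I)]
    congr 1
    push_cast
    ring
  rw [this]

/-- The abstract version of the symbol. -/
noncomputable def auxN (a b θ : ℝ) (u v : A) : A :=
  (a : ℂ) • (1 : A) + ((b / 4 : ℝ) : ℂ) • ((2 : ℂ) • (1 : A) -
        Complex.exp ((θ : ℂ) * Complex.I) • v - Complex.exp (-(θ : ℂ) * Complex.I) • u)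

lemma aux_factor (c r a b : ℝ) (h1 : c * (1 + r ^ 2) = a + b / 2) (h2 : c * r = b / 4)
    (u v : A) (huv : u * v = 1) (θ : ℝ) :
    auxN a b θ u v = (c : ℂ) • ((1 - ((r : ℂ) * Complex.exp (-(θ : ℂ) * Complex.I)) • u) *
      (1 - ((r : ℂ) * Complex.exp ((θ : ℂ) * Complex.I)) • v)) := by
  have he : Complex.exp (-(θ : ℂ) * Complex.I) * Complex.exp ((θ : ℂ) * Complex.I) = 1 := by
    rw [← Complex.exp_add]; simp
  have h1' : (c : ℂ) * (1 + r ^ 2) = a + b / 2 := by exact_mod_cast h1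
  have h2' : (c : ℂ) * r = b / 4 := by exact_mod_cast h2
  unfold auxN
  simp only [mul_sub, sub_mul, mul_one, one_mul, smul_mul_smul_comm, huv]
  generalize Complex.exp (-(θ : ℂ) * Complex.I) = e at *
  generalize Complex.exp ((θ : ℂ) * Complex.I) = f at *
  push_cast
  match_scalars
  · linear_combination -h1' - (c : ℂ) * r ^ 2 * he
  · linear_combination f * h2'
  · linear_combination e * h2'

lemma aux_main (a b : ℝ) (ha : 0 < a) (hb : 0 < b) (u v : A) (hu : ‖u‖ ≤ 1) (hv : ‖v‖ ≤ 1)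
    (huv : u * v = 1) (hvu : v * u = 1) :
    (∀ θ, IsUnit (auxN a b θ u v)) ∧
    ∫ θ in (0 : ℝ)..(2 * Real.pi), Ring.inverse (auxN a b θ u v) =
      (2 * Real.pi / Real.sqrt (a ^ 2 + a * b)) • (1 : A) := by
  set s := Real.sqrt (a ^ 2 + a * b) with hs
  have hpos : 0 < a ^ 2 + a * b := by positivity
  have hs0 : 0 < s := Real.sqrt_pos.2 hpos
  have hs2 : s ^ 2 = a ^ 2 + a * b := Real.sq_sqrt hpos.le
  have hsA : s < a + b / 2 := by
    apply lt_of_pow_lt_pow_left₀ 2 (by positivity)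
    nlinarith
  have hsa : a < s := by
    apply lt_of_pow_lt_pow_left₀ 2 (by positivity)
    nlinarith [mul_pos ha hb]
  obtain ⟨r, hr⟩ : ∃ r : ℝ, r = (a + b / 2 - s) / (b / 2) := ⟨_, rfl⟩
  obtain ⟨c, hc⟩ : ∃ c : ℝ, c = (a + b / 2 + s) / 2 := ⟨_, rfl⟩
  have hr0 : 0 ≤ r := by rw [hr]; apply div_nonneg <;> linarith
  have hr1 : r < 1 := by rw [hr, div_lt_one (by positivity)]; linarith
  have hc0 : 0 < c := by rw [hc]; positivity
  have h2 : c * r = b / 4 := by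
    rw [hc, hr]; field_simp; nlinarith
  have hbr : b / 2 * r = a + b / 2 - s := by rw [hr]; field_simp
  have h1 : c * (1 + r ^ 2) = a + b / 2 := by
    have : c * (1 + r ^ 2) = c + (c * r) * r := by ring
    rw [this, h2]; linarith
  have h3 : c * (1 - r ^ 2) = s := by
    have : c * (1 - r ^ 2) = c - (c * r) * r := by ring
    rw [this, h2]; linarith
  have hn1 : ∀ θ : ℝ, ‖Complex.exp (-(θ : ℂ) * Complex.I)‖ ≤ 1 := fun θ => by
    have := Complex.norm_exp_ofReal_mul_I (-θ)
    push_cast at this; exact this.le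
  have hn2 : ∀ θ : ℝ, ‖Complex.exp ((θ : ℂ) * Complex.I)‖ ≤ 1 := fun θ =>
    (Complex.norm_exp_ofReal_mul_I θ).le
  have hU1 := fun θ => aux_unit r hr0 hr1 u hu _ (hn1 θ)
  have hU2 := fun θ => aux_unit r hr0 hr1 v hv _ (hn2 θ)
  have hunit : ∀ θ, IsUnit (auxN a b θ u v) := fun θ => by
    rw [aux_factor c r a b h1 h2 u v huv θ]
    have hcu : IsUnit (algebraMap ℂ A c) :=
      (IsUnit.mk0 (c : ℂ) (by exact_mod_cast hc0.ne')).map (algebraMap ℂ A)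
    rw [Algebra.smul_def]
    exact hcu.mul ((hU1 θ).mul (hU2 θ))
  refine ⟨hunit, ?_⟩
  have hinv : ∀ θ : ℝ, Ring.inverse (auxN a b θ u v) =
      s⁻¹ • (Ring.inverse (1 - ((r : ℂ) * Complex.exp (-(θ : ℂ) * Complex.I)) • u) +
        Ring.inverse (1 - ((r : ℂ) * Complex.exp ((θ : ℂ) * Complex.I)) • v) - 1) := by
    intro θ
    have he : Complex.exp (-(θ : ℂ) * Complex.I) * Complex.exp ((θ : ℂ) * Complex.I) = 1 := by
      rw [← Complex.exp_add]; simp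
    have hx := Ring.mul_inverse_cancel _ (hU1 θ)
    have hy := Ring.mul_inverse_cancel _ (hU2 θ)
    rw [← mul_one (Ring.inverse (auxN a b θ u v)), Ring.inverse_mul_eq_iff_eq_mul _ _ _ (hunit θ),
      aux_factor c r a b h1 h2 u v huv θ]
    generalize Ring.inverse (1 - ((r : ℂ) * Complex.exp (-(θ : ℂ) * Complex.I)) • u) = p at *
    generalize Ring.inverse (1 - ((r : ℂ) * Complex.exp ((θ : ℂ) * Complex.I)) • v) = q at *
    have hxy : (((r : ℂ) * Complex.exp (-(θ : ℂ) * Complex.I)) • u) *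
        (((r : ℂ) * Complex.exp ((θ : ℂ) * Complex.I)) • v) = ((r ^ 2 : ℝ) : ℂ) • (1 : A) := by
      rw [smul_mul_smul_comm, huv]; congr 1; push_cast; linear_combination (r : ℂ) ^ 2 * he
    have hyx : (((r : ℂ) * Complex.exp ((θ : ℂ) * Complex.I)) • v) *
        (((r : ℂ) * Complex.exp (-(θ : ℂ) * Complex.I)) • u) = ((r ^ 2 : ℝ) : ℂ) • (1 : A) := by
      rw [smul_mul_smul_comm, hvu]; congr 1; push_cast; linear_combination (r : ℂ) ^ 2 * he
    generalize ((r : ℂ) * Complex.exp (-(θ : ℂ) * Complex.I)) • u = x at *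
    generalize ((r : ℂ) * Complex.exp ((θ : ℂ) * Complex.I)) • v = y at *
    have hcomm : (1 - x) * (1 - y) = (1 - y) * (1 - x) := by
      simp only [mul_sub, sub_mul, mul_one, one_mul, hxy, hyx]; abel
    have key : (1 - x) * (1 - y) * (p + q - 1) = ((1 - r ^ 2 : ℝ) : ℂ) • (1 : A) := by
      calc (1 - x) * (1 - y) * (p + q - 1)
          = (1 - x) * (1 - y) * p + (1 - x) * ((1 - y) * q) - (1 - x) * (1 - y) := by
            noncomm_ring
        _ = (1 - y) * ((1 - x) * p) + (1 - x) * ((1 - y) * q) - (1 - x) * (1 - y) := by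
            rw [hcomm, mul_assoc]
        _ = 1 - x * y := by rw [hx, hy]; noncomm_ring
        _ = _ := by rw [hxy]; push_cast; module
    rw [mul_smul_comm, smul_mul_assoc, key, smul_smul, ← Complex.ofReal_mul, h3,
      Complex.coe_smul, smul_smul, inv_mul_cancel₀ hs0.ne', one_smul]
  simp_rw [hinv]
  have hc1 := aux_cont r hr0 hr1 u hu (fun θ : ℝ => Complex.exp (-(θ : ℂ) * Complex.I))
    (by fun_prop) hn1
  have hc2 := aux_cont r hr0 hr1 v hv (fun θ : ℝ => Complex.exp ((θ : ℂ) * Complex.I))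
    (by fun_prop) hn2
  have hc3 := (hc1.add hc2).intervalIntegrable (μ := MeasureTheory.volume) 0 (2 * Real.pi)
  simp only [Pi.add_def] at hc3
  rw [intervalIntegral.integral_smul, intervalIntegral.integral_sub hc3 (by simp), intervalIntegral.integral_add
    (hc1.intervalIntegrable _ _) (hc2.intervalIntegrable _ _), aux_int' r hr0 hr1 u hu,
    aux_int r hr0 hr1 v hv, intervalIntegral.integral_const]
  simp only [sub_zero, add_sub_cancel_right, smul_smul]
  congr 1
  rw [div_eq_inv_mul]

end Aux

lemma aux_scalar (a b : ℝ) (ha : 0 < a) (hb : 0 < b) (φ : ℝ) :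
    ∫ θ in (0 : ℝ)..(2 * Real.pi), (a + (b / 2) * (1 - Real.cos (θ - φ)))⁻¹ =
      2 * Real.pi / Real.sqrt (a ^ 2 + a * b) := by
  have hn : ‖Complex.exp (-(φ : ℂ) * Complex.I)‖ ≤ 1 := by
    have := Complex.norm_exp_ofReal_mul_I (-φ)
    push_cast at this; exact this.le
  have h := (aux_main a b ha hb (Complex.exp ((φ : ℂ) * Complex.I))
    (Complex.exp (-(φ : ℂ) * Complex.I)) (Complex.norm_exp_ofReal_mul_I φ).le hn
    (by rw [← Complex.exp_add]; simp) (by rw [← Complex.exp_add]; simp)).2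
  have hN : ∀ θ : ℝ, Ring.inverse (auxN a b θ (Complex.exp ((φ : ℂ) * Complex.I))
      (Complex.exp (-(φ : ℂ) * Complex.I))) =
      (((a + (b / 2) * (1 - Real.cos (θ - φ)))⁻¹ : ℝ) : ℂ) := by
    intro θ
    rw [Ring.inverse_eq_inv, Complex.ofReal_inv]
    congr 1
    have e1 : Complex.exp ((θ : ℂ) * Complex.I) * Complex.exp (-(φ : ℂ) * Complex.I) =
        Complex.exp (((θ : ℂ) - φ) * Complex.I) := by
      rw [← Complex.exp_add]; congr 1; ring
    have e2 : Complex.exp (-(θ : ℂ) * Complex.I) * Complex.exp ((φ : ℂ) * Complex.I) =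
        Complex.exp (-((θ : ℂ) - φ) * Complex.I) := by
      rw [← Complex.exp_add]; congr 1; ring
    simp only [auxN, smul_eq_mul, e1, e2]
    push_cast
    rw [Complex.cos]
    ring
  simp_rw [hN] at h
  rw [intervalIntegral.integral_ofReal, Complex.real_smul, mul_one] at h
  exact_mod_cast h

theorem stmt_14 {H : Type*} [NormedAddCommGroup H] [InnerProductSpace ℂ H] [CompleteSpace H]
    [Nontrivial H] (U : H →L[ℂ] H) (hU : U ∈ unitary (H →L[ℂ] H))
    (a b : ℝ) (ha : 0 < a) (hb : 0 < b) :
    (∀ θ : ℝ, (Nop a b θ U).IsPositive ∧ IsUnit (Nop a b θ U)) ∧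
    ‖∫ θ in (0 : ℝ)..(2 * Real.pi), Ring.inverse (Nop a b θ U)‖ =
      sSup {x : ℝ | ∃ φ : ℝ, Complex.exp ((φ : ℂ) * Complex.I) ∈ spectrum ℂ U ∧
        x = ∫ θ in (0 : ℝ)..(2 * Real.pi), (a + (b / 2) * (1 - Real.cos (θ - φ)))⁻¹} ∧
    ‖∫ θ in (0 : ℝ)..(2 * Real.pi), Ring.inverse (Nop a b θ U)‖ =
      2 * Real.pi / Real.sqrt (a ^ 2 + a * b) := by
  have hU1 : star U * U = 1 := (Unitary.mem_iff.1 hU).1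
  have hU2 : U * star U = 1 := (Unitary.mem_iff.1 hU).2
  have hnU : ‖U‖ ≤ 1 := (CStarRing.norm_of_mem_unitary hU).le
  have hnV : ‖star U‖ ≤ 1 := by rw [norm_star]; exact hnU
  have hNop : ∀ θ, Nop a b θ U = auxN a b θ U (star U) := fun θ => rfl
  obtain ⟨hunit, hint⟩ := aux_main a b ha hb U (star U) hnU hnV hU2 hU1
  have hs0 : 0 < Real.sqrt (a ^ 2 + a * b) := Real.sqrt_pos.2 (by positivity)
  have hnorm : ‖∫ θ in (0 : ℝ)..(2 * Real.pi), Ring.inverse (Nop a b θ U)‖ =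
      2 * Real.pi / Real.sqrt (a ^ 2 + a * b) := by
    simp_rw [hNop]
    rw [hint, norm_smul, norm_one, mul_one, Real.norm_of_nonneg]
    have := Real.pi_pos
    positivity
  refine ⟨fun θ => ⟨?_, ?_⟩, ?_, hnorm⟩
  · have hp := ContinuousLinearMap.isPositive_adjoint_comp_self
      (1 - Complex.exp (-(θ : ℂ) * Complex.I) • U)
    have hstar : star (Complex.exp (-(θ : ℂ) * Complex.I)) =
        Complex.exp ((θ : ℂ) * Complex.I) := by
      rw [Complex.star_def, ← Complex.exp_conj]; simp
    have he : Complex.exp ((θ : ℂ) * Complex.I) * Complex.exp (-(θ : ℂ) * Complex.I) = 1 := by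
      rw [← Complex.exp_add]; simp
    have hE : (2 : ℂ) • (1 : H →L[ℂ] H) -
        Complex.exp ((θ : ℂ) * Complex.I) • ContinuousLinearMap.adjoint U -
        Complex.exp (-(θ : ℂ) * Complex.I) • U =
        star (1 - Complex.exp (-(θ : ℂ) * Complex.I) • U) *
          (1 - Complex.exp (-(θ : ℂ) * Complex.I) • U) := by
      rw [star_sub, star_one, star_smul, hstar, ← ContinuousLinearMap.star_eq_adjoint]
      simp only [mul_sub, sub_mul, mul_one, one_mul, smul_mul_smul_comm, hU1, he]
      module
    unfold Nop
    rw [hE]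
    refine (ContinuousLinearMap.isPositive_one.smul_of_nonneg ?_).add
      (ContinuousLinearMap.IsPositive.smul_of_nonneg hp ?_)
    · exact_mod_cast ha.le
    · exact_mod_cast (by positivity : (0:ℝ) ≤ b / 4)
  · rw [hNop]; exact hunit θ
  · rw [hnorm]
    simp_rw [aux_scalar a b ha hb]
    obtain ⟨z, hz⟩ := spectrum.nonempty U
    have hz1 : ‖z‖ = 1 := by
      simpa using spectrum.subset_circle_of_unitary hU hz
    have hzφ : Complex.exp ((Complex.arg z : ℂ) * Complex.I) = z := by
      have := Complex.norm_mul_exp_arg_mul_I z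
      rwa [hz1, Complex.ofReal_one, one_mul] at this
    have hset : {x : ℝ | ∃ φ : ℝ, Complex.exp ((φ : ℂ) * Complex.I) ∈ spectrum ℂ U ∧
        x = 2 * Real.pi / Real.sqrt (a ^ 2 + a * b)} =
        {2 * Real.pi / Real.sqrt (a ^ 2 + a * b)} := by
      ext x
      constructor
      · rintro ⟨φ, _, rfl⟩; rfl
      · intro hx
        exact ⟨Complex.arg z, by rw [hzφ]; exact hz, hx⟩
    rw [hset, csSup_singleton]
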